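/- Two DAGs encode the same set of d-separation statements (are Markov equivalent) if and only if they have the same skeleton and the same v-structures. -/

import Mathlib

/-- A directed acyclic graph on vertex set `Fin p`, given by its edge relation. -/
structure DAG (p : ℕ) where
  E : Fin p → Fin p → Prop
  acyclic : ∀ i, ¬ Relation.TransGen E i i

namespace DAG

variable {p : ℕ}

/-- `i` and `j` are adjacent. -/
def adj (G : DAG p) (i j : Fin p) : Prop := G.E i j ∨ G.E j i

/-- `j` is a descendant of `i` (each node is a descendant of itself). -/
def desc (G : DAG p) (i j : Fin p) : Prop := Relation.ReflTransGen G.E i j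

/-- The set of non-descendants of `k`. -/
def nd (G : DAG p) (k : Fin p) : Set (Fin p) := {i | ¬ G.desc k i}

/-- The set of parents of `k`. -/
def pa (G : DAG p) (k : Fin p) : Set (Fin p) := {i | G.E i k}

/-- `b` is a collider between `a` and `c` (on a path `a - b - c`). -/
def collider (G : DAG p) (a b c : Fin p) : Prop := G.E a b ∧ G.E c b

/-- `l` is a path from `i` to `k` in `G`: a list of pairwise distinct vertices, consecutive
vertices adjacent, starting at `i` and ending at `k`, with at least two vertices. -/
def IsPathList (G : DAG p) (l : List (Fin p)) (i k : Fin p) : Prop :=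
  l.Nodup ∧ l.Chain' G.adj ∧ l.head? = some i ∧ l.getLast? = some k ∧ 2 ≤ l.length

/-- The set `S` blocks the path `l`: some non-endpoint vertex of `l` is a non-collider in `S`,
or a collider having no descendant in `S`. -/
def blocked (G : DAG p) (S : Set (Fin p)) (l : List (Fin p)) : Prop :=
  ∃ (n : ℕ) (h : n + 2 < l.length),
    (G.collider (l.get ⟨n, by omega⟩) (l.get ⟨n + 1, by omega⟩) (l.get ⟨n + 2, h⟩) ∧
      ¬ ∃ d ∈ S, G.desc (l.get ⟨n + 1, by omega⟩) d) ∨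
    (¬ G.collider (l.get ⟨n, by omega⟩) (l.get ⟨n + 1, by omega⟩) (l.get ⟨n + 2, h⟩) ∧
      l.get ⟨n + 1, by omega⟩ ∈ S)

/-- `i` and `k` are d-connected given `S` in `G`. -/
def dConn (G : DAG p) (i k : Fin p) (S : Set (Fin p)) : Prop :=
  ∃ l, G.IsPathList l i k ∧ ¬ G.blocked S l

/-- `i` and `k` are d-separated by `S` in `G`. -/
def dSep (G : DAG p) (i k : Fin p) (S : Set (Fin p)) : Prop := ¬ G.dConn i k S

/-- The node sets `W₁` and `W₂` are d-separated by `S` in `G`. -/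
def dSepSet (G : DAG p) (W₁ W₂ S : Set (Fin p)) : Prop :=
  ∀ i ∈ W₁, ∀ k ∈ W₂, G.dSep i k S

/-- `H` is an independence map of `G`: every conditional independence constraint
(d-separation statement) encoded by `H` is also encoded by `G`. -/
def IndepMap (H G : DAG p) : Prop :=
  ∀ W₁ W₂ S : Set (Fin p), Disjoint W₁ W₂ → Disjoint W₁ S → Disjoint W₂ S →
    H.dSepSet W₁ W₂ S → G.dSepSet W₁ W₂ S

/-- The skeleton of `G` is a subgraph of the skeleton of `H`. -/
def skeletonSub (G H : DAG p) : Prop := ∀ i j, G.adj i j → H.adj i j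

/-- `(i, j, k)` is a v-structure: `i → j ← k` with `i` and `k` non-adjacent. -/
def vstruct (G : DAG p) (i j k : Fin p) : Prop :=
  G.E i j ∧ G.E k j ∧ ¬ G.adj i k ∧ i ≠ k

/-- `(i, j, k)` is a non-collider path of three (distinct) nodes in `H`. -/
def nonColliderTriple (H : DAG p) (i j k : Fin p) : Prop :=
  H.adj i j ∧ H.adj j k ∧ i ≠ k ∧ i ≠ j ∧ j ≠ k ∧ ¬ H.collider i j k

end DAG

namespace DAG

variable {p : ℕ}

def anS (G : DAG p) (S : Set (Fin p)) (b : Fin p) : Prop := ∃ d ∈ S, G.desc b d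

def ok (G : DAG p) (S : Set (Fin p)) (a b c : Fin p) : Prop :=
  ((G.E a b ∧ G.E c b) → G.anS S b) ∧ (¬ (G.E a b ∧ G.E c b) → b ∉ S)

def Act (G : DAG p) (S : Set (Fin p)) : List (Fin p) → Prop
  | [] => True
  | [_] => True
  | [a, b] => G.adj a b
  | a :: b :: c :: l => G.adj a b ∧ G.ok S a b c ∧ Act G S (b :: c :: l)

theorem asymm (G : DAG p) {a b : Fin p} (h : G.E a b) : ¬ G.E b a := fun h' =>
  G.acyclic a (.tail (.single h) h')

theorem irr (G : DAG p) {a : Fin p} : ¬ G.E a a := fun h' => G.acyclic a (.single h')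

theorem tri (G : DAG p) {a b c : Fin p} (h : G.E a b) (h2 : G.E b c) : ¬ G.E c a := fun h' =>
  G.acyclic a (.tail (.tail (.single h) h2) h')

theorem no_cyc (G : DAG p) {a b : Fin p} (h : G.E a b) (h2 : G.desc b a) : False :=
  G.acyclic a (Relation.TransGen.head' h h2)

theorem anS_of_E (G : DAG p) {S : Set (Fin p)} {a b : Fin p} (h : G.E a b) (h2 : G.anS S b) :
    G.anS S a := by
  obtain ⟨d, hd, hh⟩ := h2
  exact ⟨d, hd, Relation.ReflTransGen.head h hh⟩

theorem anS_self (G : DAG p) {S : Set (Fin p)} {a : Fin p} (h : a ∈ S) : G.anS S a :=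
  ⟨a, h, .refl⟩

theorem adj_symm (G : DAG p) {a b : Fin p} (h : G.adj a b) : G.adj b a := Or.symm h

theorem ok_symm (G : DAG p) {S : Set (Fin p)} {a b c : Fin p} (h : G.ok S a b c) :
    G.ok S c b a := by
  unfold ok at *; tauto

theorem act_cons (G : DAG p) (S : Set (Fin p)) (a b c : Fin p) (l : List (Fin p)) :
    G.Act S (a :: b :: c :: l) ↔ G.adj a b ∧ G.ok S a b c ∧ G.Act S (b :: c :: l) := by
  rw [Act]

theorem act_adj (G : DAG p) {S : Set (Fin p)} {a b : Fin p} {l : List (Fin p)}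
    (h : G.Act S (a :: b :: l)) : G.adj a b := by
  cases l with
  | nil => exact h
  | cons c l => exact ((G.act_cons ..).1 h).1

theorem act_tail (G : DAG p) {S : Set (Fin p)} {a : Fin p} {l : List (Fin p)}
    (h : G.Act S (a :: l)) : G.Act S l := by
  match l, h with
  | [], _ => trivial
  | [_], _ => trivial
  | _ :: _ :: _, h => exact ((G.act_cons ..).1 h).2.2

theorem act_suffix (G : DAG p) {S : Set (Fin p)} {Q : List (Fin p)} (P : List (Fin p))
    (h : G.Act S (P ++ Q)) : G.Act S Q := by
  induction P with
  | nil => exact h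
  | cons a P ih => exact ih (G.act_tail h)

/-- zipper at an edge -/
theorem act_zip (G : DAG p) (S : Set (Fin p)) (P : List (Fin p)) :
    ∀ (a b : Fin p) (Q : List (Fin p)),
    G.Act S (P.reverse ++ a :: b :: Q) ↔ G.Act S (b :: a :: P) ∧ G.Act S (a :: b :: Q) := by
  induction P with
  | nil =>
    intro a b Q
    simp only [List.reverse_nil, List.nil_append]
    exact ⟨fun h => ⟨G.adj_symm (G.act_adj h), h⟩, fun h => h.2⟩
  | cons z P ih =>
    intro a b Q
    have := ih z a (b :: Q)
    simp only [List.reverse_cons, List.append_assoc, List.singleton_append]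
    rw [this, act_cons, act_cons]
    constructor
    · rintro ⟨h1, h2, h3, h4⟩
      exact ⟨⟨G.adj_symm (G.act_adj h4), G.ok_symm h3, h1⟩, h4⟩
    · rintro ⟨⟨h1, h2, h3⟩, h4⟩
      exact ⟨h3, G.adj_symm (G.act_adj h3), G.ok_symm h2, h4⟩

theorem act_rev (G : DAG p) {S : Set (Fin p)} {l : List (Fin p)} (h : G.Act S l) :
    G.Act S l.reverse := by
  match l, h with
  | [], _ => trivial
  | [_], _ => trivial
  | a :: b :: Q, h =>
    have h2 := (G.act_zip S Q b a []).2 ⟨h, G.adj_symm (G.act_adj h)⟩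
    simpa using h2

theorem act_rep (G : DAG p) {S : Set (Fin p)} {a b c : Fin p} {P : List (Fin p)}
    (h : G.Act S (b :: a :: P)) (hc : G.adj c a)
    (H : ∀ z P', P = z :: P' → G.adj a z → G.ok S b a z → G.ok S c a z) :
    G.Act S (c :: a :: P) := by
  cases P with
  | nil => exact hc
  | cons z P =>
    rw [act_cons] at h ⊢
    exact ⟨hc, H z P rfl (G.act_adj h.2.2) h.2.1, h.2.2⟩

theorem act_iff (G : DAG p) (S : Set (Fin p)) : ∀ l : List (Fin p),
    G.Act S l ↔ l.Chain' G.adj ∧ ¬ G.blocked S l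
  | [] => by simp [Act, blocked, List.Chain']
  | [_] => by simp [Act, blocked, List.Chain']
  | [a, b] => by simp [Act, blocked, List.Chain']
  | a :: b :: c :: l => by
    have ih := act_iff G S (b :: c :: l)
    rw [act_cons, ih]
    have : G.blocked S (a :: b :: c :: l) ↔ ¬ G.ok S a b c ∨ G.blocked S (b :: c :: l) := by
      constructor
      · rintro ⟨n, h, H⟩
        cases n with
        | zero =>
          left
          simp [collider] at H
          unfold ok anS
          simp only [not_and, not_exists]
          rcases H with H | H
          · intro h1; exfalso
            obtain ⟨d, hd, h2⟩ := h1 H.1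
            exact H.2 d hd h2
          · intro _ h2; exact h2 (by tauto) H.2
        | succ n =>
          right
          exact ⟨n, by simpa using h, by simpa using H⟩
      · rintro (H | ⟨n, h, H⟩)
        · refine ⟨0, by simp, ?_⟩
          simp only [collider]
          unfold ok anS at H
          simp
          by_cases hh : G.E a b ∧ G.E c b
          · left
            refine ⟨hh, ?_⟩
            by_contra h3
            push Not at h3
            exact H ⟨fun _ => h3, fun h => absurd hh h⟩
          · right
            refine ⟨by tauto, ?_⟩
            by_contra h3
            exact H ⟨fun h => absurd h hh, fun _ => h3⟩
        · exact ⟨n + 1, by simpa using h, by simpa using H⟩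
    rw [this]
    simp only [List.Chain', List.isChain_cons_cons]
    tauto

theorem dir_walk (G : DAG p) {S : Set (Fin p)} : ∀ (L : List (Fin p)) (x y t : Fin p),
    G.Act S (x :: y :: L) → G.E x y → (y :: L).getLast? = some t → G.anS S y ∨ G.desc y t := by
  intro L
  induction L with
  | nil =>
    intro x y t _ _ h
    simp at h
    subst h
    exact Or.inr .refl
  | cons w L ih =>
    intro x y t h hE hl
    rw [act_cons] at h
    obtain ⟨h1, h2, h3⟩ := h
    by_cases hw : G.E w y
    · exact Or.inl (h2.1 ⟨hE, hw⟩)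
    · have hyw : G.E y w := (G.act_adj h3).resolve_right hw
      rcases ih y w t h3 hyw (by simpa using hl) with h | h
      · exact Or.inl (G.anS_of_E hyw h)
      · exact Or.inr (Relation.ReflTransGen.head hyw h)

def Conn (G : DAG p) (S : Set (Fin p)) (i k : Fin p) (l : List (Fin p)) : Prop :=
  G.Act S l ∧ l.head? = some i ∧ l.getLast? = some k

theorem conn_rev (G : DAG p) {S : Set (Fin p)} {i k : Fin p} {l : List (Fin p)}
    (h : G.Conn S i k l) : G.Conn S k i l.reverse :=
  ⟨G.act_rev h.1, by simpa using h.2.2, by simpa using h.2.1⟩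

theorem dConn_iff (G : DAG p) {S : Set (Fin p)} {i k : Fin p} (hik : i ≠ k) :
    G.dConn i k S ↔ ∃ l, l.Nodup ∧ G.Conn S i k l := by
  unfold dConn IsPathList Conn
  simp only [act_iff]
  constructor
  · rintro ⟨l, h⟩; exact ⟨l, by tauto⟩
  · rintro ⟨l, h1, h2, h3, h4⟩
    refine ⟨l, ⟨h1, h2.1, h3, h4, ?_⟩, h2.2⟩
    match l, h3, h4 with
    | [], h3, _ => simp at h3
    | [a], h3, h4 =>
      simp at h3 h4
      exact absurd (h3.symm.trans h4) hik
    | a :: b :: l, _, _ => simp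

theorem dConn_symm (G : DAG p) {S : Set (Fin p)} {i k : Fin p} (hik : i ≠ k)
    (h : G.dConn i k S) : G.dConn k i S := by
  rw [dConn_iff G hik] at h
  rw [dConn_iff G hik.symm]
  obtain ⟨l, h1, h2⟩ := h
  exact ⟨l.reverse, by simpa using h1, G.conn_rev h2⟩

theorem sep_pa (G : DAG p) {i j : Fin p} (hij : i ≠ j) (ha : ¬ G.adj i j) (hd : ¬ G.desc j i) :
    G.dSep j i (G.pa j) := by
  intro h
  rw [dConn_iff G hij.symm] at h
  obtain ⟨l, h1, hA, hh, hl⟩ := h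
  match l, hh, hl, hA with
  | [], hh, _, _ => simp at hh
  | [a], hh, hl, _ =>
    simp at hh hl
    exact hij (hl.symm.trans hh)
  | a :: m :: L, hh, hl, hA =>
    simp at hh
    subst hh
    rcases G.act_adj hA with hE | hE
    · rcases G.dir_walk L a m i hA hE (by simpa using hl) with ⟨d, hd, h⟩ | h
      · exact G.no_cyc hE (h.tail hd)
      · exact hd (Relation.ReflTransGen.head hE h)
    · cases L with
      | nil =>
        simp at hl
        subst hl
        exact ha (Or.inl hE)
      | cons w L =>
        rw [act_cons] at hA
        exact hA.2.1.2 (fun h => G.asymm hE h.1) hE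

theorem exists_sep (G : DAG p) {i j : Fin p} (hij : i ≠ j) (ha : ¬ G.adj i j) :
    ∃ S : Set (Fin p), i ∉ S ∧ j ∉ S ∧ G.dSep i j S := by
  by_cases hd : G.desc j i
  · have hd' : ¬ G.desc i j := by
      intro h
      rcases Relation.ReflTransGen.cases_head h with h | ⟨c, h1, h2⟩
      · exact hij h
      · exact G.no_cyc h1 (h2.trans hd)
    exact ⟨G.pa i, G.irr, fun h => ha (Or.inr h),
      G.sep_pa hij.symm (fun h => ha (G.adj_symm h)) hd'⟩
  · exact ⟨G.pa j, fun h => ha (Or.inl h), G.irr,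
      fun h => G.sep_pa hij ha hd (G.dConn_symm hij h)⟩

theorem conn_adj (G : DAG p) {i j : Fin p} (S : Set (Fin p)) (hij : i ≠ j) (ha : G.adj i j) :
    G.dConn i j S := by
  rw [dConn_iff G hij]
  exact ⟨[i, j], by simpa using hij, ha, by simp, by simp⟩

theorem conn_tri (G : DAG p) {i j k : Fin p} {S : Set (Fin p)} (hik : i ≠ k) (hij : i ≠ j)
    (hjk : j ≠ k) (h1 : G.adj i j) (h2 : G.adj j k) (h : G.ok S i j k) : G.dConn i k S := by
  rw [dConn_iff G hik]
  exact ⟨[i, j, k], by simp; tauto, (G.act_cons ..).2 ⟨h1, h, h2⟩, by simp, by simp⟩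

theorem adj_ne (G : DAG p) {i j : Fin p} (h : G.adj i j) : i ≠ j := by
  rintro rfl
  exact h.elim G.irr G.irr

theorem fwd_adj {G₁ G₂ : DAG p}
    (H : ∀ i k S, i ≠ k → i ∉ S → k ∉ S → (G₁.dConn i k S ↔ G₂.dConn i k S))
    {i j : Fin p} (h : G₁.adj i j) : G₂.adj i j := by
  by_contra hn
  have hij := G₁.adj_ne h
  obtain ⟨S, h1, h2, h3⟩ := G₂.exists_sep hij hn
  exact h3 ((H i j S hij h1 h2).1 (G₁.conn_adj S hij h))

theorem fwd_v {G₁ G₂ : DAG p}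
    (H : ∀ i k S, i ≠ k → i ∉ S → k ∉ S → (G₁.dConn i k S ↔ G₂.dConn i k S))
    {i j k : Fin p} (h : G₁.vstruct i j k) : G₂.vstruct i j k := by
  have H' : ∀ i k S, i ≠ k → i ∉ S → k ∉ S → (G₂.dConn i k S ↔ G₁.dConn i k S) :=
    fun i k S a b c => (H i k S a b c).symm
  obtain ⟨hij, hkj, hn, hik⟩ := h
  have a1 : G₂.adj i j := fwd_adj H (Or.inl hij)
  have a2 : G₂.adj j k := fwd_adj H (Or.inr hkj)
  have hn2 : ¬ G₂.adj i k := fun h => hn (fwd_adj H' h)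
  by_cases hc : G₂.E i j ∧ G₂.E k j
  · exact ⟨hc.1, hc.2, hn2, hik⟩
  exfalso
  obtain ⟨S, h1, h2, h3⟩ := G₂.exists_sep hik hn2
  by_cases hj : j ∈ S
  · refine h3 ((H i k S hik h1 h2).1 (G₁.conn_tri hik (G₂.adj_ne a1) (G₂.adj_ne a2)
      (Or.inl hij) (Or.inr hkj) ⟨fun _ => G₁.anS_self hj, fun h => absurd ⟨hij, hkj⟩ h⟩))
  · exact h3 (G₂.conn_tri hik (G₂.adj_ne a1) (G₂.adj_ne a2) a1 a2
      ⟨fun h => absurd h hc, fun _ => hj⟩)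

/-! Backward direction -/

noncomputable def rk (G : DAG p) (v : Fin p) : ℕ := Set.ncard {d | G.desc v d}

theorem rk_pos (G : DAG p) (v : Fin p) : 0 < G.rk v :=
  (Set.ncard_pos (Set.toFinite _)).2 ⟨v, .refl⟩

theorem rk_lt (G : DAG p) {a b : Fin p} (h : G.E a b) : G.rk b < G.rk a := by
  refine Set.ncard_lt_ncard ⟨fun d hd => Relation.ReflTransGen.head h hd, fun hs => ?_⟩
    (Set.toFinite _)
  exact G.no_cyc h (hs (show a ∈ {d | G.desc a d} from .refl))

noncomputable def mu (G : DAG p) (l : List (Fin p)) : ℕ := (l.map G.rk).sum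

def Mini (G : DAG p) (S : Set (Fin p)) (i k : Fin p) (l : List (Fin p)) : Prop :=
  G.Conn S i k l ∧ ∀ l', G.Conn S i k l' → G.mu l ≤ G.mu l'

theorem mini_rev (G : DAG p) {S : Set (Fin p)} {i k : Fin p} {l : List (Fin p)}
    (h : G.Mini S i k l) : G.Mini S k i l.reverse := by
  refine ⟨G.conn_rev h.1, fun l' h' => ?_⟩
  have := h.2 _ (G.conn_rev h')
  simpa [mu, List.sum_reverse] using this

theorem exists_mini (G : DAG p) {S : Set (Fin p)} {i k : Fin p} {l : List (Fin p)}
    (h : G.Conn S i k l) : ∃ l, G.Mini S i k l := by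
  classical
  have hex : ∃ n, ∃ l, G.Conn S i k l ∧ G.mu l = n := ⟨_, l, h, rfl⟩
  obtain ⟨l, h1, h2⟩ := Nat.find_spec hex
  exact ⟨l, h1, fun l' h' => h2 ▸ Nat.find_min' hex ⟨l', h', rfl⟩⟩

theorem mini_short (G : DAG p) {S : Set (Fin p)} {i k a b c : Fin p} {P Q : List (Fin p)}
    (h : G.Mini S i k (P.reverse ++ a :: b :: c :: Q)) (h1 : G.Act S (c :: a :: P))
    (h2 : G.Act S (a :: c :: Q)) : False := by
  have := h.2 (P.reverse ++ a :: c :: Q) ⟨(G.act_zip ..).2 ⟨h1, h2⟩,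
    by simpa [List.head?_append] using h.1.2.1,
    by simpa [List.getLast?_append] using h.1.2.2⟩
  have := G.rk_pos b
  simp [mu] at *
  omega

theorem mini_repl (G : DAG p) {S : Set (Fin p)} {i k a b c d : Fin p} {P Q : List (Fin p)}
    (h : G.Mini S i k (P.reverse ++ a :: b :: c :: Q)) (hbd : G.E b d)
    (h1 : G.Act S (d :: a :: P)) (h3 : G.ok S a d c)
    (h2 : G.Act S (d :: c :: Q)) : False := by
  have := h.2 (P.reverse ++ a :: d :: c :: Q) ⟨(G.act_zip ..).2
      ⟨h1, (G.act_cons ..).2 ⟨G.adj_symm (G.act_adj h1), h3, h2⟩⟩,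
    by simpa [List.head?_append] using h.1.2.1,
    by simpa [List.getLast?_append] using h.1.2.2⟩
  have := G.rk_lt hbd
  simp [mu] at *
  omega

theorem mini_parts (G : DAG p) {S : Set (Fin p)} {i k a b c : Fin p} {P Q : List (Fin p)}
    (h : G.Mini S i k (P.reverse ++ a :: b :: c :: Q)) :
    G.Act S (b :: a :: P) ∧ G.ok S a b c ∧ G.Act S (b :: c :: Q) ∧ G.adj a b ∧ G.adj b c := by
  have := (G.act_zip ..).1 h.1.1
  rw [G.act_cons S a b c] at this
  exact ⟨this.1, this.2.2.1, this.2.2.2, this.2.1, G.act_adj this.2.2.2⟩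

theorem mini_flip (G : DAG p) {S : Set (Fin p)} {i k a b c : Fin p} {P Q : List (Fin p)}
    (h : G.Mini S i k (P.reverse ++ a :: b :: c :: Q)) :
    G.Mini S k i (Q.reverse ++ c :: b :: a :: P) := by
  simpa using G.mini_rev h

theorem ok_of_tails (G : DAG p) {S : Set (Fin p)} {a b c z : Fin p} (h1 : G.E a b) (h2 : G.E a c)
    (h : G.ok S b a z) : G.ok S c a z :=
  ⟨fun hh => absurd hh.1 (G.asymm h2), fun _ => h.2 (fun hh => G.asymm h1 hh.1)⟩

theorem ok_of_heads (G : DAG p) {S : Set (Fin p)} {a b c z : Fin p} (h1 : G.E b a) (h2 : G.E c a)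
    (h : G.ok S b a z) : G.ok S c a z :=
  ⟨fun hh => h.1 ⟨h1, hh.2⟩, fun hh => h.2 (fun h => hh ⟨h2, h.2⟩)⟩

/-- tail becomes head, with the vertex an ancestor of `S` -/
theorem ok_of_tail_head (G : DAG p) {S : Set (Fin p)} {a b c z : Fin p} (h1 : G.E a b)
    (hs : G.anS S a) (h : G.ok S b a z) : G.ok S c a z :=
  ⟨fun _ => hs, fun _ => h.2 (fun h => G.asymm h1 h.1)⟩

theorem mini_chain (G : DAG p) {S : Set (Fin p)} {i k a b c : Fin p} {P Q : List (Fin p)}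
    (h : G.Mini S i k (P.reverse ++ a :: b :: c :: Q)) (h1 : G.E a b) (h2 : G.E b c) :
    ¬ G.adj a c := by
  intro hac
  have hac : G.E a c := hac.resolve_right (G.tri h1 h2)
  obtain ⟨A, o, B, -, -⟩ := G.mini_parts h
  exact G.mini_short h (G.act_rep A (Or.inr hac) fun z _ _ _ => G.ok_of_tails h1 hac)
    (G.act_rep B (Or.inl hac) fun z _ _ _ => G.ok_of_heads h2 hac)

theorem mini_coll (G : DAG p) {S : Set (Fin p)} {i k a b c : Fin p} {P Q : List (Fin p)}
    (h : G.Mini S i k (P.reverse ++ a :: b :: c :: Q)) (h1 : G.E a b) (h2 : G.E c b) :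
    ¬ G.E a c := by
  intro hac
  obtain ⟨A, o, B, -, -⟩ := G.mini_parts h
  exact G.mini_short h (G.act_rep A (Or.inr hac) fun z _ _ _ => G.ok_of_tails h1 hac)
    (G.act_rep B (Or.inl hac) fun z _ _ _ =>
      G.ok_of_tail_head h2 (G.anS_of_E h2 (o.1 ⟨h1, h2⟩)))

theorem mini_fork (G : DAG p) {S : Set (Fin p)} {i k a b c : Fin p} {P Q : List (Fin p)}
    (h : G.Mini S i k (P.reverse ++ a :: b :: c :: Q)) (h1 : G.E b a) (h2 : G.E b c)
    (hac : G.E a c) : ∃ z P', P = z :: P' ∧ G.E z a ∧ ¬ G.adj z b := by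
  by_contra hcon
  obtain ⟨A, o, B, -, -⟩ := G.mini_parts h
  have hbS : b ∉ S := o.2 (fun h => G.asymm h2 h.2)
  refine G.mini_short h (G.act_rep A (Or.inr hac) fun z P' hP haz hok => ?_)
    (G.act_rep B (Or.inl hac) fun z _ _ _ => G.ok_of_heads h2 hac)
  refine ⟨fun hh => absurd hh.1 (G.asymm hac), fun _ haS => ?_⟩
  have hza : G.E z a := by
    by_contra hz
    exact hok.2 (fun hh => hz hh.2) haS
  have hzb : G.adj z b := by
    by_contra hz
    exact hcon ⟨z, P', hP, hza, hz⟩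
  subst hP
  have A' := ((G.act_cons ..).1 A).2.2
  have h' : G.Mini S i k (P'.reverse ++ z :: a :: b :: c :: Q) := by simpa using h
  have o' : G.ok S z b c := ⟨fun hh => absurd hh.2 (G.asymm h2), fun _ => hbS⟩
  refine G.mini_short h' ?_ ((G.act_cons ..).2 ⟨hzb, o', B⟩)
  rcases hzb with hzb | hbz
  · exact G.act_rep A' (Or.inr hzb) fun _ _ _ _ => G.ok_of_tails hza hzb
  · exact G.act_rep A' (Or.inl hbz) fun _ _ _ _ =>
      G.ok_of_tail_head hza (G.anS_of_E hza (G.anS_self haS))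

theorem dup_split : ∀ l : List (Fin p), ¬ l.Nodup → ∃ P v M Q, l = P ++ v :: (M ++ v :: Q)
  | [], h => absurd List.nodup_nil h
  | a :: l, h => by
    by_cases ha : a ∈ l
    · obtain ⟨M, Q, rfl⟩ := List.append_of_mem ha
      exact ⟨[], a, M, Q, rfl⟩
    · have : ¬ l.Nodup := fun hl => h (List.nodup_cons.2 ⟨ha, hl⟩)
      obtain ⟨P, v, M, Q, rfl⟩ := dup_split l this
      exact ⟨a :: P, v, M, Q, rfl⟩

theorem act_cut (G : DAG p) {S : Set (Fin p)} {v : Fin p} {P M Q : List (Fin p)}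
    (h : G.Act S (P.reverse ++ v :: (M ++ v :: Q))) : G.Act S (P.reverse ++ v :: Q) := by
  have hvQ : G.Act S (v :: Q) := by
    apply G.act_suffix (P.reverse ++ v :: M)
    simpa using h
  have hvP : G.Act S (v :: P) := by
    have := G.act_rev h
    apply G.act_suffix (Q.reverse ++ v :: M.reverse)
    simpa using this
  cases P with
  | nil => simpa using hvQ
  | cons z P =>
  cases Q with
  | nil => simpa using G.act_rev hvP
  | cons y Q =>
  cases M with
  | nil =>
    have : G.Act S (v :: v :: y :: Q) := G.act_suffix _ h
    exact absurd rfl (G.adj_ne (G.act_adj this))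
  | cons m M =>
  have e1 : G.Act S (P.reverse ++ z :: v :: m :: (M ++ v :: y :: Q)) := by simpa using h
  have e2 := ((G.act_zip ..).1 e1).2
  have o1 := ((G.act_cons ..).1 e2).2.1
  have e4 := ((G.act_cons ..).1 e2).2.2
  have e3 : G.Act S ((z :: v :: (m :: M)) ++ v :: y :: Q) := by simpa using e2
  obtain ⟨M', x, hx⟩ : ∃ M' x, m :: M = M' ++ [x] :=
    ⟨(m :: M).dropLast, (m :: M).getLast (by simp), (List.dropLast_append_getLast _).symm⟩
  have o2 : G.ok S x v y := by
    rw [hx] at e3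
    have : G.Act S (x :: v :: y :: Q) := by
      apply G.act_suffix (z :: v :: M')
      simpa using e3
    exact ((G.act_cons ..).1 this).2.1
  have key : G.ok S z v y := by
    constructor
    · rintro ⟨hz, hy⟩
      by_cases hm : G.E m v
      · exact o1.1 ⟨hz, hm⟩
      have hvm : G.E v m := (G.act_adj e4).resolve_right hm
      have e5 : G.Act S (v :: m :: (M ++ [v])) := by
        have : G.Act S ((y :: Q).reverse ++ (v :: m :: (M ++ [v])).reverse) := by
          have := G.act_rev e4
          simpa using this
        have := G.act_rev (G.act_suffix _ this)
        simpa using this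
      rcases G.dir_walk _ v m v e5 hvm (by
        rw [← List.cons_append]; exact List.getLast?_concat ..) with h | h
      · exact G.anS_of_E hvm h
      · exact (G.no_cyc hvm h).elim
    · intro hn
      by_cases hz : G.E z v
      · exact o2.2 fun hh => hn ⟨hz, hh.2⟩
      · exact o1.2 fun hh => hz hh.1
  have := (G.act_zip S P z v (y :: Q)).2
    ⟨hvP, (G.act_cons ..).2 ⟨G.adj_symm (G.act_adj hvP), key, hvQ⟩⟩
  simpa using this

theorem mini_nodup (G : DAG p) {S : Set (Fin p)} {i k : Fin p} {l : List (Fin p)}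
    (h : G.Mini S i k l) : l.Nodup := by
  by_contra hn
  obtain ⟨P, v, M, Q, rfl⟩ := dup_split l hn
  have hA := h.1.1
  rw [← List.reverse_reverse P] at hA
  have hA := G.act_cut hA
  rw [List.reverse_reverse] at hA
  have := h.2 (P ++ v :: Q) ⟨hA, by simpa [List.head?_append] using h.1.2.1, by
    have := h.1.2.2
    simp [List.getLast?_append, List.getLast?_cons] at this ⊢
    exact this⟩
  have := G.rk_pos v
  simp [mu] at *
  omega

def Dist (G : DAG p) (S : Set (Fin p)) : ℕ → Fin p → Prop
  | 0, v => v ∈ S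
  | n + 1, v => ∃ u, G.E v u ∧ Dist G S n u

theorem exists_dist (G : DAG p) {S : Set (Fin p)} {b : Fin p} (h : G.anS S b) :
    ∃ n, G.Dist S n b := by
  obtain ⟨d, hd, h⟩ := h
  induction h using Relation.ReflTransGen.head_induction_on with
  | refl => exact ⟨0, hd⟩
  | head h _ ih =>
    obtain ⟨n, hn⟩ := ih
    exact ⟨n + 1, _, h, hn⟩

theorem dist_transfer {G₁ G₂ : DAG p} {S : Set (Fin p)}
    (hadj : ∀ i j : Fin p, G₁.adj i j ↔ G₂.adj i j)
    (hv : ∀ i j k : Fin p, G₁.vstruct i j k ↔ G₂.vstruct i j k) (n : ℕ) :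
    ∀ u v : Fin p, G₁.E u v → G₂.E u v → G₁.Dist S n v → (∀ m < n + 1, ¬ G₁.Dist S m u) →
      G₂.anS S v := by
  induction n with
  | zero => exact fun u v _ _ h _ => G₂.anS_self h
  | succ n ih =>
    rintro u v h1 h2 ⟨w, hvw, hw⟩ hmin
    have hnadj : ¬ G₁.adj u w := by
      rintro (h | h)
      · exact hmin (n + 1) (by omega) ⟨w, h, hw⟩
      · exact G₁.tri h1 hvw h
    have huw : u ≠ w := by
      rintro rfl
      exact G₁.asymm h1 hvw
    have h2' : G₂.E v w := by
      refine ((hadj v w).1 (Or.inl hvw)).resolve_right fun h => ?_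
      have := (hv u v w).2 ⟨h2, h, fun h => hnadj ((hadj _ _).2 h), huw⟩
      exact G₁.asymm hvw this.2.1
    exact G₂.anS_of_E h2' (ih v w hvw h2' hw fun m hm hd =>
      hmin (m + 1) (by omega) ⟨v, h1, hd⟩)

theorem mini_ok {G₁ G₂ : DAG p} {S : Set (Fin p)}
    (hadj : ∀ i j : Fin p, G₁.adj i j ↔ G₂.adj i j)
    (hv : ∀ i j k : Fin p, G₁.vstruct i j k ↔ G₂.vstruct i j k)
    {i k a b c : Fin p} {P Q : List (Fin p)}
    (h : G₁.Mini S i k (P.reverse ++ a :: b :: c :: Q)) : G₂.ok S a b c := by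
  classical
  obtain ⟨A, o, B, hab, hbc⟩ := G₁.mini_parts h
  have hnd := G₁.mini_nodup h
  have hac : a ≠ c := by
    rintro rfl
    simp [List.nodup_append] at hnd
  by_cases hc : G₁.E a b ∧ G₁.E c b
  · have hnadj : ¬ G₁.adj a c := by
      rintro (h' | h')
      · exact G₁.mini_coll h hc.1 hc.2 h'
      · exact G₁.mini_coll (G₁.mini_flip h) hc.2 hc.1 h'
    have hv2 := (hv a b c).1 ⟨hc.1, hc.2, hnadj, hac⟩
    refine ⟨fun _ => ?_, fun hn => absurd ⟨hv2.1, hv2.2.1⟩ hn⟩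
    have hex := G₁.exists_dist (o.1 hc)
    have hmin : ∀ m < Nat.find hex, ¬ G₁.Dist S m b := fun m hm => Nat.find_min hex hm
    have hD := Nat.find_spec hex
    generalize Nat.find hex = n at hmin hD
    cases n with
    | zero => exact G₂.anS_self hD
    | succ n =>
      obtain ⟨d, hbd, hd⟩ := hD
      by_cases h2 : G₂.E b d
      · exact G₂.anS_of_E h2 (dist_transfer hadj hv n b d hbd h2 hd hmin)
      exfalso
      have hdb : G₂.E d b := ((hadj b d).1 (Or.inl hbd)).resolve_left h2
      have step : ∀ x, G₁.E x b → G₂.E x b → G₁.E x d := by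
        intro x hx hx2
        by_contra hxd
        have hnx : ¬ G₁.adj x d := by
          rintro (h | h)
          · exact hxd h
          · exact G₁.tri hx hbd h
        have hne : x ≠ d := by
          rintro rfl
          exact G₁.asymm hx hbd
        have := (hv x b d).2 ⟨hx2, hdb, fun h => hnx ((hadj _ _).2 h), hne⟩
        exact G₁.asymm hbd this.2.1
      have had := step a hc.1 hv2.1
      have hcd := step c hc.2 hv2.2.1
      have hdS : G₁.anS S d := by
        clear hmin
        clear step
        have : ∀ n v, G₁.Dist S n v → G₁.anS S v := by
          intro n
          induction n with
          | zero => exact fun v h => G₁.anS_self h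
          | succ n ih => exact fun v ⟨u, h1, h2⟩ => G₁.anS_of_E h1 (ih u h2)
        exact this n d hd
      exact G₁.mini_repl h hbd
        (G₁.act_rep A (Or.inr had) fun _ _ _ _ => G₁.ok_of_tails hc.1 had)
        ⟨fun _ => hdS, fun hn => absurd ⟨had, hcd⟩ hn⟩
        (G₁.act_rep B (Or.inr hcd) fun _ _ _ _ => G₁.ok_of_tails hc.2 hcd)
  · have hbS := o.2 hc
    refine ⟨fun hc2 => ?_, fun _ => hbS⟩
    exfalso
    by_cases hs : G₁.adj a c
    · have hba : G₁.E b a := by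
        refine hab.resolve_left fun h1 => ?_
        have h2 : G₁.E b c := hbc.resolve_right fun h2 => hc ⟨h1, h2⟩
        exact G₁.mini_chain h h1 h2 hs
      have hbc' : G₁.E b c := by
        refine hbc.resolve_right fun h1 => ?_
        exact G₁.mini_chain (G₁.mini_flip h) h1 hba (G₁.adj_symm hs)
      rcases hs with hs | hs
      · obtain ⟨z, P', rfl, hz, hzb⟩ := G₁.mini_fork h hba hbc' hs
        have hne : z ≠ b := by
          rintro rfl
          simp [List.nodup_append] at hnd
        have := (hv z a b).1 ⟨hz, hba, hzb, hne⟩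
        exact G₂.asymm this.2.1 hc2.1
      · obtain ⟨z, P', rfl, hz, hzb⟩ := G₁.mini_fork (G₁.mini_flip h) hbc' hba hs
        have hne : z ≠ b := by
          rintro rfl
          simp [List.nodup_append] at hnd
        have := (hv z c b).1 ⟨hz, hbc', hzb, hne⟩
        exact G₂.asymm this.2.1 hc2.2
    · have := (hv a b c).2 ⟨hc2.1, hc2.2, fun h => hs ((hadj _ _).2 h), hac⟩
      exact hc ⟨this.1, this.2.1⟩

theorem act_of_triples {G₁ G₂ : DAG p} {S : Set (Fin p)}
    (hadj : ∀ i j : Fin p, G₁.adj i j ↔ G₂.adj i j) : ∀ l : List (Fin p), G₁.Act S l →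
    (∀ P a b c Q, l = P ++ a :: b :: c :: Q → G₂.ok S a b c) → G₂.Act S l
  | [], _, _ => trivial
  | [_], _, _ => trivial
  | [a, b], h, _ => (hadj a b).1 h
  | a :: b :: c :: l, h, H => by
    rw [act_cons] at h ⊢
    refine ⟨(hadj a b).1 h.1, H [] a b c l rfl, act_of_triples hadj _ h.2.2 ?_⟩
    intro P x y z Q e
    exact H (a :: P) x y z Q (by simp [e])

theorem bwd {G₁ G₂ : DAG p} {S : Set (Fin p)}
    (hadj : ∀ i j : Fin p, G₁.adj i j ↔ G₂.adj i j)
    (hv : ∀ i j k : Fin p, G₁.vstruct i j k ↔ G₂.vstruct i j k)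
    {i k : Fin p} (hik : i ≠ k) (h : G₁.dConn i k S) : G₂.dConn i k S := by
  rw [dConn_iff _ hik] at h ⊢
  obtain ⟨l, -, h⟩ := h
  obtain ⟨l, h⟩ := G₁.exists_mini h
  refine ⟨l, G₁.mini_nodup h, act_of_triples hadj l h.1.1 ?_, h.1.2⟩
  intro P a b c Q e
  apply mini_ok hadj hv (P := P.reverse) (Q := Q) (i := i) (k := k)
  rw [List.reverse_reverse, ← e]
  exact h

end DAG

open DAG in
/-- **Verma–Pearl.** Two DAGs encode the same d-separation statements (are Markov equivalent)
iff they have the same skeleton and the same v-structures. -/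
theorem markov_equiv_iff {p : ℕ} (G₁ G₂ : DAG p) :
    (∀ W₁ W₂ S : Set (Fin p), Disjoint W₁ W₂ → Disjoint W₁ S → Disjoint W₂ S →
        (G₁.dSepSet W₁ W₂ S ↔ G₂.dSepSet W₁ W₂ S)) ↔
      ((∀ i j : Fin p, G₁.adj i j ↔ G₂.adj i j) ∧
        (∀ i j k : Fin p, G₁.vstruct i j k ↔ G₂.vstruct i j k)) := by
  constructor
  · intro H
    have H1 : ∀ i k S, i ≠ k → i ∉ S → k ∉ S → (G₁.dConn i k S ↔ G₂.dConn i k S) := by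
      intro i k S hik hi hk
      have := H {i} {k} S (by simpa using hik) (by simpa using hi) (by simpa using hk)
      simp only [dSepSet, dSep, Set.mem_singleton_iff, forall_eq] at this
      exact not_iff_not.1 this
    have H2 : ∀ i k S, i ≠ k → i ∉ S → k ∉ S → (G₂.dConn i k S ↔ G₁.dConn i k S) :=
      fun i k S a b c => (H1 i k S a b c).symm
    exact ⟨fun i j => ⟨fwd_adj H1, fwd_adj H2⟩, fun i j k => ⟨fwd_v H1, fwd_v H2⟩⟩
  · rintro ⟨hadj, hv⟩ W₁ W₂ S hW h1 h2
    have hne : ∀ i ∈ W₁, ∀ k ∈ W₂, i ≠ k := by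
      rintro i hi k hk rfl
      exact Set.disjoint_left.1 hW hi hk
    constructor
    · intro h i hi k hk hc
      exact h i hi k hk (bwd (fun i j => (hadj i j).symm) (fun i j k => (hv i j k).symm)
        (hne i hi k hk) hc)
    · intro h i hi k hk hc
      exact h i hi k hk (bwd hadj hv (hne i hi k hk) hc)
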